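/- arXiv:2303.10711 — 11 statements merged into one kernel-verified Lean document; each statement's English description precedes it below -/
import Mathlib

section
/- Let k ≥ 1, let M be a finite set, and consider the first-order language L with exactly k unary relation symbols U_1,…,U_k (and no other symbols), interpreted in the structure ⟨M, W_1,…,W_k⟩ where W_i ⊆ M. Then a subset A ⊆ M is definable in this structure by a first-order formula φ(x) without parameters if and only if there exists E ⊆ {0,1}^k such that A = ⋃_{e ∈ E} (W_1^{e(1)} ∩ W_2^{e(2)} ∩ ⋯ ∩ W_k^{e(k)}), where W_i^1 = W_i and W_i^0 = M ∖ W_i. -/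
open FirstOrder

/-- The first-order language with exactly `k` unary relation symbols `U_1, …, U_k`
(and no other symbols). -/
def unaryLang (k : ℕ) : FirstOrder.Language where
  Functions := fun _ => Empty
  Relations := fun n =>
    match n with
    | 1 => Fin k
    | _ => Empty

/-- The `unaryLang k`-structure `⟨M, W_1, …, W_k⟩` in which the `i`-th unary relation
symbol is interpreted by the set `W i ⊆ M`. -/
def unaryStructure (k : ℕ) (M : Type) (W : Fin k → Set M) :
    (unaryLang k).Structure M where
  funMap := fun {n} f _ => Empty.elim f
  RelMap := fun {n} r =>
    match n, r with
    | 1, i => fun x => x 0 ∈ W i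

open FirstOrder.Language in
/-- The transposition of two points lying in the same sets `W i` is an automorphism of
`⟨M, W_1, …, W_k⟩`. -/
noncomputable def unaryStructureSwap {k : ℕ} {M : Type} {W : Fin k → Set M} [DecidableEq M]
    {a b : M} (h : ∀ i, a ∈ W i ↔ b ∈ W i) :
    letI := unaryStructure k M W; M ≃[unaryLang k] M :=
  let _ := unaryStructure k M W
  { Equiv.swap a b with
    map_fun' := fun {_} f _ => Empty.elim f
    map_rel' := fun {n} r x => by
      match n, r with
      | 1, i =>
        change Equiv.swap a b (x 0) ∈ W i ↔ x 0 ∈ W i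
        rw [Equiv.swap_apply_def]
        have := h i
        split_ifs <;> simp_all }

/-- Points lying in the same sets `W i` satisfy the same formulas. -/
theorem unaryStructure_realize_congr {k : ℕ} {M : Type} {W : Fin k → Set M} {a b : M}
    (h : ∀ i, a ∈ W i ↔ b ∈ W i) {α : Type*} (φ : (unaryLang k).Formula α) :
    letI := unaryStructure k M W
    φ.Realize (fun _ => a) ↔ φ.Realize (fun _ => b) := by
  classical
  let _ := unaryStructure k M W
  have key := FirstOrder.Language.StrongHomClass.realize_formula (unaryStructureSwap h) φ
    (v := fun _ => a)
  have hv : (unaryStructureSwap h ∘ fun _ : α => a) = fun _ => b :=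
    funext fun _ => Equiv.swap_apply_left a b
  rw [hv] at key
  exact key.symm

/-- The atomic formula `U_i x`. -/
def unaryAtomic {k : ℕ} (i : Fin k) : (unaryLang k).Formula (Fin 1) :=
  FirstOrder.Language.Relations.formula (L := unaryLang k) (n := 1) i
    fun _ => FirstOrder.Language.Term.var 0

theorem realize_unaryAtomic {k : ℕ} {M : Type} {W : Fin k → Set M} (i : Fin k) (a : M) :
    letI := unaryStructure k M W
    (unaryAtomic i).Realize (fun _ => a) ↔ a ∈ W i := by
  let _ := unaryStructure k M W
  exact FirstOrder.Language.Formula.realize_rel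

/-- For a finite `M` and the structure `⟨M, W_1, …, W_k⟩` for the language with `k` unary
predicates, a set `A ⊆ M` is definable by a first-order formula without parameters iff
`A = ⋃_{e ∈ E} (W_1^{e(1)} ∩ ⋯ ∩ W_k^{e(k)})` for some `E ⊆ {0,1}^k`, where `W^1 = W`
and `W^0 = M \ W`. -/
theorem stmt1 (k : ℕ) (hk : 1 ≤ k) (M : Type) [Fintype M]
    (W : Fin k → Set M) (A : Set M) :
    (∃ φ : (unaryLang k).Formula (Fin 1),
        A = {a : M | letI := unaryStructure k M W; φ.Realize (fun _ => a)}) ↔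
      ∃ E : Set (Fin k → Bool),
        A = ⋃ e ∈ E, ⋂ i : Fin k, (if e i = true then W i else (W i)ᶜ) := by
  classical
  let _ := unaryStructure k M W
  constructor
  · rintro ⟨φ, rfl⟩
    refine ⟨{e | ∃ b, φ.Realize (fun _ => b) ∧ ∀ i, e i = true ↔ b ∈ W i}, ?_⟩
    ext a
    simp only [Set.mem_iUnion, Set.mem_iInter, Set.mem_ofPred_eq, exists_prop]
    constructor
    · intro ha
      refine ⟨fun i => decide (a ∈ W i), ⟨a, ha, by simp⟩, fun i => ?_⟩
      by_cases hi : a ∈ W i <;> simp [hi]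
    · rintro ⟨e, ⟨b, hb, hbe⟩, hae⟩
      refine (unaryStructure_realize_congr (fun i => ?_) φ).1 hb
      rw [← hbe i]
      have := hae i
      by_cases hi : e i = true <;> simp_all
  · rintro ⟨E, rfl⟩
    refine ⟨FirstOrder.Language.Formula.iSup fun e : E =>
      FirstOrder.Language.Formula.iInf fun i : Fin k =>
        if e.1 i = true then unaryAtomic i else (unaryAtomic i).not, ?_⟩
    ext a
    simp only [Set.mem_iUnion, Set.mem_iInter, Set.mem_ofPred_eq,
      FirstOrder.Language.Formula.realize_iSup, FirstOrder.Language.Formula.realize_iInf,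
      Subtype.exists]
    refine exists_congr fun e => exists_congr fun _ => forall_congr' fun i => ?_
    split_ifs
    · exact (realize_unaryAtomic i a).symm
    · rw [FirstOrder.Language.Formula.realize_not, realize_unaryAtomic]
      rfl
end

section
/- Let k ≥ 1, let 1 ≤ p ≤ k, let 1 ≤ i_1 < i_2 < ⋯ < i_p ≤ k be a p-subsequence of ⟨1,…,k⟩, and let e ∈ {0,1}^k. Identifying a structure for the language L = {U_1,…,U_k} on the universe {1,…,2n} with a k-tuple (W_1,…,W_k) of subsets of Fin (2n), the fraction of such k-tuples for which |W_{i_1}^{e(i_1)} ∩ W_{i_2}^{e(i_2)} ∩ ⋯ ∩ W_{i_p}^{e(i_p)}| = n (out of all (2^{2n})^k tuples) tends to 0 as n → ∞. That is, every basic property φ_{s̄,e}(x) of L = {U_1,…,U_k} is regular; in particular every atom φ_e(x), and every U_i(x) and ¬U_i(x), is regular. -/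
/-- Doubling the ground set pays off as long as its size stays at most `2 * n`. -/
lemma choose_mul_two_pow_le_centralBinom (n d a : ℕ) (h : a + d = 2 * n) :
    a.choose n * 2 ^ d ≤ n.centralBinom := by
  induction d generalizing a with
  | zero => simp [Nat.centralBinom, ← h]
  | succ d ih =>
    refine le_trans ?_ (ih (a + 1) (by omega))
    have key : a.choose n * 2 ≤ (a + 1).choose n := by
      obtain _ | m := n
      · omega
      · rw [Nat.choose_succ_succ']
        have h1 := Nat.choose_succ_right_eq a m
        have h2 : a.choose m * (a - m) ≤ a.choose m * (m + 1) :=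
          Nat.mul_le_mul_left _ (by omega)
        have := Nat.le_of_mul_le_mul_right (h1.trans_le h2) (Nat.succ_pos m)
        omega
    calc a.choose n * 2 ^ (d + 1) = a.choose n * 2 * 2 ^ d := by ring
      _ ≤ _ := Nat.mul_le_mul_right _ key

lemma centralBinom_sq_mul_le (n : ℕ) : n.centralBinom ^ 2 * (2 * n + 1) ≤ 16 ^ n := by
  induction n with
  | zero => simp
  | succ n ih =>
    have h := Nat.succ_mul_centralBinom_succ n
    refine le_of_mul_le_mul_left ?_ (show 0 < (n + 1) ^ 2 by positivity)
    calc (n + 1) ^ 2 * ((n + 1).centralBinom ^ 2 * (2 * (n + 1) + 1))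
        = ((n + 1) * (n + 1).centralBinom) ^ 2 * (2 * n + 3) := by ring
      _ = n.centralBinom ^ 2 * (2 * n + 1) * (4 * ((2 * n + 1) * (2 * n + 3))) := by
        rw [h]; ring
      _ ≤ 16 ^ n * (16 * (n + 1) ^ 2) := Nat.mul_le_mul ih (by nlinarith)
      _ = (n + 1) ^ 2 * 16 ^ (n + 1) := by ring

lemma centralBinom_div_four_pow_le (n : ℕ) :
    (n.centralBinom : ℝ) / 4 ^ n ≤ (√(2 * n + 1))⁻¹ := by
  have h : (n.centralBinom : ℝ) ^ 2 * (2 * n + 1) ≤ 16 ^ n := by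
    exact_mod_cast centralBinom_sq_mul_le n
  have hpos : (0 : ℝ) < √(2 * n + 1) := by positivity
  rw [div_le_iff₀ (by positivity), inv_mul_eq_div, le_div_iff₀ hpos]
  refine le_of_sq_le_sq ?_ (by positivity)
  rw [mul_pow, Real.sq_sqrt (by positivity), ← pow_mul, mul_comm n 2, pow_mul]
  norm_num
  exact h

lemma tendsto_centralBinom_div_four_pow :
    Filter.Tendsto (fun n : ℕ => (n.centralBinom : ℝ) / 4 ^ n) Filter.atTop (nhds 0) := by
  refine squeeze_zero (fun n => by positivity) centralBinom_div_four_pow_le ?_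
  refine (Real.tendsto_sqrt_atTop.comp ?_).inv_tendsto_atTop
  exact Filter.tendsto_atTop_add_const_right _ _
    (tendsto_natCast_atTop_atTop.const_mul_atTop two_pos)

open Finset in
open Classical in
/-- Sets whose trace (or the trace of whose complement) on `A` has exactly `n` elements. -/
lemma card_trace_eq_le {α : Type*} [Fintype α] (A : Finset α) (b : Bool) (n : ℕ) :
    #{V : Set α | #{x ∈ A | x ∈ V ↔ b = true} = n} ≤ (#A).choose n * 2 ^ #Aᶜ := by
  rw [← card_powersetCard, ← card_powerset, ← card_product]
  refine card_le_card_of_injOn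
    (fun V => ({x ∈ A | x ∈ V ↔ b = true}, {x ∈ Aᶜ | x ∈ V})) ?_ ?_
  · intro V hV
    have hV' := (mem_filter.1 hV).2
    exact mem_product.2
      ⟨mem_powersetCard.2 ⟨filter_subset _ _, hV'⟩, mem_powerset.2 (filter_subset _ _)⟩
  · intro V _ V' _ h
    simp only [Prod.mk.injEq, Finset.ext_iff, mem_filter, mem_compl] at h
    ext x
    have h1 := h.1 x
    have h2 := h.2 x
    tauto

open Finset in
open Classical in
lemma card_neutral_le {κ ι α : Type*} [Fintype κ] [Fintype ι] [Fintype α]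
    (i : κ → ι) (j₀ : κ) (e : ι → Bool) (n : ℕ)
    (hα : Fintype.card α = 2 * n) :
    #{W : ι → Set α | #{x : α | ∀ j, (x ∈ W (i j) ↔ e (i j) = true)} = n} ≤
      n.centralBinom * (2 ^ (2 * n)) ^ (Fintype.card ι - 1) := by
  have ht : #(univ : Finset ({l : ι // l ≠ i j₀} → Set α)) =
      (2 ^ (2 * n)) ^ (Fintype.card ι - 1) := by
    simp [hα, Fintype.card_subtype_compl]
  rw [← ht]
  refine card_le_mul_card_image_of_maps_to (f := fun W l => W l.1) (fun _ _ => mem_univ _) _ ?_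
  intro r _
  set A : Finset α := {x | ∀ j (h : i j ≠ i j₀), (x ∈ r ⟨i j, h⟩ ↔ e (i j) = true)} with hA
  calc _ ≤ #{V : Set α | #{x ∈ A | x ∈ V ↔ e (i j₀) = true} = n} := by
        refine card_le_card_of_injOn (fun W => W (i j₀)) ?_ ?_
        · intro W hW
          simp only [coe_filter, mem_filter, mem_univ, true_and, Set.mem_ofPred_eq] at hW ⊢
          obtain ⟨hW, rfl⟩ := hW
          rw [← hW]
          congr 1
          ext x
          simp only [hA, mem_filter, mem_univ, true_and]
          refine ⟨fun h j => ?_, fun h => ⟨fun j _ => h j, h j₀⟩⟩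
          by_cases hj : i j = i j₀
          · rw [hj]; exact h.2
          · exact h.1 j hj
        · intro W hW W' hW' h
          simp only [coe_filter, mem_filter, mem_univ, true_and, Set.mem_ofPred_eq] at hW hW'
          funext l
          by_cases hl : l = i j₀
          · rw [hl]; exact h
          · exact congrFun (hW.2.trans hW'.2.symm) ⟨l, hl⟩
    _ ≤ (#A).choose n * 2 ^ #Aᶜ := card_trace_eq_le _ _ _
    _ ≤ n.centralBinom :=
      choose_mul_two_pow_le_centralBinom _ _ _ (by rw [card_add_card_compl, hα])


/-- Every basic property `φ_{s̄,e}(x)` of `L = {U_1,…,U_k}` is regular: identifying a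
structure on `Fin (2n)` with a `k`-tuple `W` of subsets, the fraction of tuples for which
`|W_{i_1}^{e(i_1)} ∩ ⋯ ∩ W_{i_p}^{e(i_p)}| = n` tends to `0` as `n → ∞`. -/
theorem stmt2 (k p : ℕ) (hk : 1 ≤ k) (hp : 1 ≤ p) (hpk : p ≤ k)
    (i : Fin p → Fin k) (hi : StrictMono i) (e : Fin k → Bool) :
    Filter.Tendsto
      (fun n : ℕ =>
        (Nat.card {W : Fin k → Set (Fin (2 * n)) //
            Nat.card {x : Fin (2 * n) // ∀ j : Fin p, (x ∈ W (i j) ↔ e (i j) = true)} = n} : ℝ)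
          / ((2 : ℝ) ^ (2 * n)) ^ k)
      Filter.atTop (nhds 0) := by
  classical
  refine squeeze_zero (fun n => by positivity) (fun n => ?_) tendsto_centralBinom_div_four_pow
  have h := card_neutral_le i ⟨0, hp⟩ e n (Fintype.card_fin (2 * n))
  obtain ⟨m, rfl⟩ : ∃ m, k = m + 1 := ⟨k - 1, by omega⟩
  simp only [Nat.card_eq_fintype_card, Fintype.card_subtype]
  rw [div_le_div_iff₀ (by positivity) (by positivity)]
  have h' := (Nat.cast_le (α := ℝ)).2 h
  simp only [Fintype.card_fin, Nat.add_sub_cancel, Nat.cast_mul, Nat.cast_pow,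
    Nat.cast_ofNat] at h'
  calc _ ≤ (n.centralBinom : ℝ) * (2 ^ (2 * n)) ^ m * 4 ^ n := by
        gcongr
        convert h'
        rfl
    _ = _ := by
        rw [pow_succ, pow_mul 2 2 n]
        norm_num
        ring
end

section
/- Let k ≥ 2, let 2 ≤ p ≤ k, let 1 ≤ i_1 < i_2 < ⋯ < i_p ≤ k, and let e ∈ {0,1}^k. Identifying a structure for L = {U_1,…,U_k} on the universe {1,…,n} with a k-tuple (W_1,…,W_k) of subsets of Fin n, the fraction of such k-tuples for which 2·|W_{i_1}^{e(i_1)} ∩ ⋯ ∩ W_{i_p}^{e(i_p)}| > n (out of all (2^n)^k tuples) tends to 0 as n → ∞. That is, every basic property φ_{s̄,e}(x) with s̄ a p-subsequence for p ≥ 2 has typicality degree d(φ_{s̄,e} : typ) = 0. -/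
/-- Prescribing membership of two distinct points leaves at most a quarter of all subsets. -/
theorem four_mul_card_le_of_two_constraints {ι : Type*} [Finite ι] {a b : ι} (hab : a ≠ b)
    {P : Set ι → Prop} {ea eb : Prop} (hP : ∀ A, P A → (a ∈ A ↔ ea) ∧ (b ∈ A ↔ eb)) :
    4 * Nat.card {A : Set ι // P A} ≤ 2 ^ Nat.card ι := by
  classical
  let F : {A : Set ι // P A} × Bool × Bool → Set ι := fun q =>
    {j | if j = a then q.2.1 = true else if j = b then q.2.2 = true else j ∈ q.1.1}
  have hF : Function.Injective F := by
    rintro ⟨⟨A, hA⟩, u, v⟩ ⟨⟨B, hB⟩, u', v'⟩ h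
    have h' (j : ι) := Set.ext_iff.mp h j
    simp only [F, Set.mem_ofPred_eq] at h'
    have hu : u = u' := Bool.eq_iff_iff.mpr <| by simpa using h' a
    have hv : v = v' := Bool.eq_iff_iff.mpr <| by simpa [hab.symm] using h' b
    have hAB : A = B := by
      ext j
      by_cases hja : j = a
      · rw [hja, (hP A hA).1, (hP B hB).1]
      by_cases hjb : j = b
      · rw [hjb, (hP A hA).2, (hP B hB).2]
      simpa [hja, hjb] using h' j
    subst hu hv hAB
    rfl
  have hle := Nat.card_le_card_of_injective F hF
  have hpow : Nat.card (Set ι) = 2 ^ Nat.card ι := by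
    have := Fintype.ofFinite ι
    simp
  rw [hpow, Nat.card_prod, Nat.card_prod, Nat.card_eq_fintype_card (α := Bool),
    Fintype.card_bool] at hle
  omega

/-- Chernoff bound: if `P` holds for at most a quarter of a finite type, few functions into it
take values satisfying `P` on more than half of their domain. -/
theorem card_majority_le {α : Type*} [Finite α] {P : α → Prop}
    (hP : 4 * Nat.card {a // P a} ≤ Nat.card α) (n : ℕ) :
    (Nat.card {f : Fin n → α // n < 2 * Nat.card {x // P (f x)}} : ℝ) ≤
      (7 / 8 * Nat.card α) ^ n := by
  classical
  have := Fintype.ofFinite α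
  let w : α → ℝ := fun a => if P a then 3 / 2 else 2 / 3
  have hw0 (a : α) : 0 ≤ w a := by dsimp only [w]; split_ifs <;> norm_num
  have hsum : ∑ a, w a ≤ 7 / 8 * Nat.card α := by
    have hw (a : α) : w a = 2 / 3 + if P a then 5 / 6 else 0 := by
      dsimp only [w]; split_ifs <;> norm_num
    have hP' : (4 : ℝ) * Nat.card {a // P a} ≤ Nat.card α := by exact_mod_cast hP
    rw [Nat.card_eq_fintype_card, Nat.card_eq_fintype_card, Fintype.card_subtype] at hP'
    simp only [hw, Finset.sum_add_distrib, ← Finset.sum_filter, Finset.sum_const, nsmul_eq_mul,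
      Finset.card_univ, Nat.card_eq_fintype_card]
    linarith
  have hone (f : Fin n → α) (hf : n < 2 * Nat.card {x // P (f x)}) : 1 ≤ ∏ x, w (f x) := by
    rw [Nat.card_eq_fintype_card, Fintype.card_subtype] at hf
    have hcard := Finset.card_filter_add_card_filter_not (s := Finset.univ) (fun x => P (f x))
    rw [Finset.card_univ, Fintype.card_fin] at hcard
    simp only [w, Finset.prod_ite, Finset.prod_const]
    set z := (Finset.univ.filter fun x => P (f x)).card
    set y := (Finset.univ.filter fun x => ¬ P (f x)).card
    calc (1 : ℝ) = (3 / 2) ^ y * (2 / 3) ^ y := by rw [← mul_pow]; norm_num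
      _ ≤ (3 / 2) ^ z * (2 / 3) ^ y := by
        gcongr
        · norm_num
        · omega
  calc (Nat.card {f : Fin n → α // n < 2 * Nat.card {x // P (f x)}} : ℝ)
      = ∑ f : Fin n → α, if n < 2 * Nat.card {x // P (f x)} then (1 : ℝ) else 0 := by
        rw [Finset.sum_boole, Nat.card_eq_fintype_card, Fintype.card_subtype]
    _ ≤ ∑ f : Fin n → α, ∏ x, w (f x) := by
        refine Finset.sum_le_sum fun f _ => ?_
        split_ifs with hf
        · exact hone f hf
        · exact Finset.prod_nonneg fun x _ => hw0 _
    _ = (∑ a, w a) ^ n := by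
        rw [Fintype.sum_pow]
    _ ≤ _ := by
        gcongr

/-- For `L = {U_1,…,U_k}` and a basic property `φ_{s̄,e}(x)` given by a `p`-subsequence
with `p ≥ 2`, the typicality degree is `0`: the fraction of `k`-tuples `W` of subsets of
`Fin n` with `2·|W_{i_1}^{e(i_1)} ∩ ⋯ ∩ W_{i_p}^{e(i_p)}| > n` tends to `0`. -/
theorem stmt4 (k p : ℕ) (hk : 2 ≤ k) (hp : 2 ≤ p) (hpk : p ≤ k)
    (i : Fin p → Fin k) (hi : StrictMono i) (e : Fin k → Bool) :
    Filter.Tendsto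
      (fun n : ℕ =>
        (Nat.card {W : Fin k → Set (Fin n) //
            n < 2 * Nat.card {x : Fin n // ∀ j : Fin p, (x ∈ W (i j) ↔ e (i j) = true)}} : ℝ)
          / ((2 : ℝ) ^ n) ^ k)
      Filter.atTop (nhds 0) := by
  let P : Set (Fin k) → Prop := fun A => ∀ j : Fin p, (i j ∈ A ↔ e (i j) = true)
  have hab : i ⟨0, by omega⟩ ≠ i ⟨1, by omega⟩ := fun h => by simpa using hi.injective h
  have hcard : Nat.card (Set (Fin k)) = 2 ^ k := by simp
  have hP : 4 * Nat.card {A // P A} ≤ Nat.card (Set (Fin k)) := by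
    have := four_mul_card_le_of_two_constraints hab (P := P) fun A hA => ⟨hA _, hA _⟩
    rwa [Nat.card_fin, ← hcard] at this
  refine squeeze_zero (fun n => by positivity) (fun n => ?_)
    (tendsto_pow_atTop_nhds_zero_of_lt_one (r := (7 / 8 : ℝ)) (by norm_num) (by norm_num))
  have htranspose : Nat.card {W : Fin k → Set (Fin n) //
      n < 2 * Nat.card {x : Fin n // ∀ j : Fin p, (x ∈ W (i j) ↔ e (i j) = true)}} =
      Nat.card {f : Fin n → Set (Fin k) // n < 2 * Nat.card {x // P (f x)}} :=
    Nat.card_congr <| Equiv.subtypeEquiv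
      (Equiv.piComm fun (_ : Fin k) (_ : Fin n) => Prop) fun _ => Iff.rfl
  rw [htranspose, div_le_iff₀ (by positivity), ← pow_mul, mul_comm n k, pow_mul, ← mul_pow]
  simpa [hcard] using card_majority_le hP n
end

section
/- The limit, as n → ∞, of the ratio |{f : Fin n → Fin n | 2·|{x : f x ≠ x}| > n}| / n^n equals 1. That is, for the language L = {F} with one unary function symbol, the property φ(x) := (F(x) ≠ x) has typicality degree d(φ:typ) = 1. -/
/-- A self-map of a finite nonempty type has exactly one fixed point on average. -/
theorem sum_card_fixedPoints_eq {α : Type*} [Fintype α] [DecidableEq α] [Nonempty α] :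
    ∑ f : α → α, (Finset.univ.filter fun x => f x = x).card
      = Fintype.card α ^ Fintype.card α := by
  have key (x : α) : (Finset.univ.filter fun f : α → α => f x = x).card
      = Fintype.card α ^ (Fintype.card α - 1) := by
    simpa using Fintype.card_filter_piFinset_const_eq_of_mem
      (Finset.univ : Finset α) x (Finset.mem_univ x)
  calc ∑ f : α → α, (Finset.univ.filter fun x => f x = x).card
      = ∑ x : α, (Finset.univ.filter fun f : α → α => f x = x).card :=
        Finset.sum_card_bipartiteAbove_eq_sum_card_bipartiteBelow (fun (f : α → α) x => f x = x)
    _ = Fintype.card α ^ Fintype.card α := by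
        simp only [key, Finset.sum_const, Finset.card_univ, smul_eq_mul]
        exact mul_pow_sub_one Fintype.card_ne_zero _

/-- By Markov's inequality, at most a `2 / n` fraction of the self-maps of an `n`-element type
fix at least half of the points. -/
theorem card_half_fixed_mul_card_le {α : Type*} [Fintype α] [DecidableEq α] [Nonempty α] :
    (Finset.univ.filter fun f : α → α =>
        2 * (Finset.univ.filter fun x => f x ≠ x).card ≤ Fintype.card α).card * Fintype.card α
      ≤ 2 * Fintype.card α ^ Fintype.card α := by
  rw [← sum_card_fixedPoints_eq, Finset.mul_sum, ← smul_eq_mul]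
  refine (Finset.card_nsmul_le_sum _ _ _ fun f hf => ?_).trans
    (Finset.sum_le_sum_of_subset (Finset.filter_subset _ _))
  have h := Finset.card_filter_add_card_filter_not (s := Finset.univ) (fun x => f x = x)
  simp only [Finset.mem_filter, Finset.mem_univ, true_and, Finset.card_univ, ne_eq] at hf h
  omega


/-- For the language `L = {F}` with one unary function symbol, the property
`φ(x) := (F(x) ≠ x)` has typicality degree `d(φ:typ) = 1`. -/
theorem stmt9 :
    Filter.Tendsto
      (fun n : ℕ =>
        (Nat.card {f : Fin n → Fin n // n < 2 * Nat.card {x : Fin n // f x ≠ x}} : ℝ)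
          / (n : ℝ) ^ n)
      Filter.atTop (nhds 1) := by
  have hlim : Filter.Tendsto (fun n : ℕ => 1 - 2 / (n : ℝ)) Filter.atTop (nhds 1) := by
    simpa using (tendsto_const_div_atTop_nhds_zero_nat (2 : ℝ)).const_sub 1
  have hcard (n : ℕ) :
      Nat.card {f : Fin n → Fin n // n < 2 * Nat.card {x : Fin n // f x ≠ x}}
        + (Finset.univ.filter fun f : Fin n → Fin n =>
            2 * (Finset.univ.filter fun x => f x ≠ x).card ≤ n).card = n ^ n := by
    have h := Finset.card_filter_add_card_filter_not (s := Finset.univ)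
      (fun f : Fin n → Fin n => n < 2 * (Finset.univ.filter fun x => f x ≠ x).card)
    simpa [Nat.card_eq_fintype_card, Fintype.card_subtype] using h
  refine tendsto_of_tendsto_of_tendsto_of_le_of_le' hlim tendsto_const_nhds ?_ ?_
  · filter_upwards [Filter.eventually_gt_atTop 0] with n hn
    have : NeZero n := ⟨hn.ne'⟩
    have hbad := card_half_fixed_mul_card_le (α := Fin n)
    have hsum := hcard n
    rw [Fintype.card_fin] at hbad
    have hn' : (0 : ℝ) < n := by exact_mod_cast hn
    rw [← @Nat.cast_inj ℝ] at hsum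
    rw [← @Nat.cast_le ℝ] at hbad
    push_cast at hsum hbad
    rw [← le_div_iff₀ hn'] at hbad
    rw [le_div_iff₀ (by positivity), sub_mul, one_mul, div_mul_eq_mul_div]
    linarith
  · refine Filter.Eventually.of_forall fun n => div_le_one_of_le₀ ?_ (by positivity)
    exact_mod_cast (Nat.le_add_right _ _).trans_eq (hcard n)
end

section
/- The limit, as n → ∞, of the ratio |{f : Fin (2n) → Fin (2n) | |{x : f x ≠ x}| = n}| / (2n)^{2n} equals 0. That is, for the language L = {F} with one unary function symbol, the property φ(x) := (F(x) ≠ x) is regular. -/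
open Finset in
/-- On a nonempty finite type, a self-map has exactly one fixed point on average. -/
theorem sum_card_fixedPoints (α : Type*) [Fintype α] [DecidableEq α] [Nonempty α] :
    ∑ f : α → α, #{x | f x = x} = Fintype.card α ^ Fintype.card α := by
  have hx (x : α) : #{f : α → α | f x = x} = Fintype.card α ^ (Fintype.card α - 1) := by
    simpa using Fintype.card_filter_piFinset_const_eq_of_mem (univ : Finset α) x (mem_univ x)
  calc ∑ f : α → α, #{x | f x = x} = ∑ x : α, #{f : α → α | f x = x} := by
        simp only [card_filter]
        exact sum_comm
    _ = Fintype.card α ^ Fintype.card α := by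
        simp only [hx, sum_const, card_univ, smul_eq_mul]
        exact mul_pow_sub_one Fintype.card_ne_zero _

open Finset in
/-- Markov's inequality for the number of fixed points of a self-map. -/
theorem card_mul_le_of_le_card_fixedPoints (α : Type*) [Fintype α] [DecidableEq α] [Nonempty α]
    (k : ℕ) (s : Finset (α → α)) (hs : ∀ f ∈ s, k ≤ #{x | f x = x}) :
    #s * k ≤ Fintype.card α ^ Fintype.card α := by
  rw [← sum_card_fixedPoints α, ← smul_eq_mul]
  exact (card_nsmul_le_sum s _ k hs).trans
    (sum_le_sum_of_subset (subset_univ s))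

/-- For the language `L = {F}` with one unary function symbol, the property
`φ(x) := (F(x) ≠ x)` is regular: the fraction of structures of size `2n` in which the
extension of `φ` has cardinality exactly `n` tends to `0`. -/
theorem stmt10 :
    Filter.Tendsto
      (fun n : ℕ =>
        (Nat.card {f : Fin (2 * n) → Fin (2 * n) //
            Nat.card {x : Fin (2 * n) // f x ≠ x} = n} : ℝ)
          / (2 * n : ℝ) ^ (2 * n))
      Filter.atTop (nhds 0) := by
  refine squeeze_zero' (.of_forall fun n => by positivity) ?_
    (tendsto_inv_atTop_nhds_zero_nat (𝕜 := ℝ))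
  filter_upwards [Filter.eventually_gt_atTop 0] with n hn
  have : NeZero (2 * n) := ⟨by omega⟩
  have hn' : (0 : ℝ) < n := by exact_mod_cast hn
  have key := card_mul_le_of_le_card_fixedPoints (Fin (2 * n)) n
    {f | Nat.card {x : Fin (2 * n) // f x ≠ x} = n} fun f hf => by
      simp only [Finset.mem_filter_univ, Nat.card_eq_fintype_card, Fintype.card_subtype, ne_eq] at hf
      have h := Finset.card_filter_add_card_filter_not (s := Finset.univ) (fun x => f x = x)
      rw [Finset.card_univ, Fintype.card_fin] at h
      omega
  rw [← Fintype.card_subtype, ← Nat.card_eq_fintype_card, Fintype.card_fin] at key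
  rw [div_le_iff₀ (by positivity), inv_mul_eq_div, le_div_iff₀ hn']
  exact_mod_cast key
end

section
/- For every m ≥ 1, the fraction of functions f : Fin n → Fin n such that |{x : f x ≠ x}| ≥ m (out of all n^n functions) tends to 1 as n → ∞. That is, for the language L = {F}, μ((F(x) ≠ x)^{(m)}) = 1 for every m ≥ 1. -/
/-- A fixed point at a prescribed place costs one factor `n`. -/
theorem card_filter_apply_eq_self {n : ℕ} (x : Fin n) :
    (Finset.univ.filter fun f : Fin n → Fin n => f x = x).card = n ^ (n - 1) := by
  have h : (Finset.univ.filter fun f : Fin n → Fin n => f x = x)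
      = Fintype.piFinset (Function.update (fun _ : Fin n => (Finset.univ : Finset (Fin n))) x
        ({x} : Finset (Fin n))) := by
    ext f
    simp only [Finset.mem_filter, Finset.mem_univ, true_and, Fintype.mem_piFinset]
    constructor
    · intro hf a
      by_cases ha : a = x
      · subst ha; simpa using hf
      · simp [Function.update_of_ne ha]
    · intro hf
      simpa using hf x
  rw [h, Fintype.card_piFinset, ← Finset.mul_prod_erase _ _ (Finset.mem_univ x),
    Finset.prod_congr rfl (g := fun _ => n)]
  · simp [Finset.card_erase_of_mem]
  · intro a ha
    simp [Function.update_of_ne (Finset.ne_of_mem_erase ha)]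

/-- On average, a self-map of a finite nonempty set has exactly one fixed point. -/
theorem sum_card_fixed_points {n : ℕ} (hn : n ≠ 0) :
    ∑ f : Fin n → Fin n, (Finset.univ.filter fun x => f x = x).card = n ^ n := by
  simp_rw [Finset.card_filter]
  rw [Finset.sum_comm]
  simp_rw [← Finset.card_filter, card_filter_apply_eq_self]
  simp [mul_pow_sub_one hn]

/-- Markov's inequality for the number of fixed points. -/
theorem card_few_moved_mul_le {n m : ℕ} (hn : n ≠ 0) :
    (Finset.univ.filter fun f : Fin n → Fin n =>
      ¬ m ≤ (Finset.univ.filter fun x => f x ≠ x).card).card * (n - m) ≤ n ^ n := by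
  rw [← sum_card_fixed_points hn, ← smul_eq_mul]
  refine (Finset.card_nsmul_le_sum _ (fun f => (Finset.univ.filter fun x => f x = x).card) _
    fun f hf => ?_).trans (Finset.sum_le_sum_of_subset (Finset.filter_subset _ _))
  have h := Finset.card_filter_add_card_filter_not (s := Finset.univ) (fun x => f x = x)
  simp only [Finset.mem_filter, Finset.mem_univ, true_and, ne_eq, Finset.card_univ,
    Fintype.card_fin] at hf h
  omega

/-- For the language `L = {F}` with one unary function symbol, `μ((F(x) ≠ x)^{(m)}) = 1`
for every `m ≥ 1`. -/
theorem stmt12 (m : ℕ) (hm : 1 ≤ m) :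
    Filter.Tendsto
      (fun n : ℕ =>
        (Nat.card {f : Fin n → Fin n // m ≤ Nat.card {x : Fin n // f x ≠ x}} : ℝ)
          / (n : ℝ) ^ n)
      Filter.atTop (nhds 1) := by
  have hcard (n : ℕ) : Nat.card {f : Fin n → Fin n // m ≤ Nat.card {x : Fin n // f x ≠ x}}
      = (Finset.univ.filter fun f : Fin n → Fin n =>
        m ≤ (Finset.univ.filter fun x => f x ≠ x).card).card := by
    simp only [Nat.card_eq_fintype_card, Fintype.card_subtype]
  simp_rw [hcard]
  have hadd (n : ℕ) := Finset.card_filter_add_card_filter_not (s := Finset.univ)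
    (fun f : Fin n → Fin n => m ≤ (Finset.univ.filter fun x => f x ≠ x).card)
  simp only [Finset.card_univ, Fintype.card_fun, Fintype.card_fin] at hadd
  have hlim : Filter.Tendsto (fun n : ℕ => 1 - ((n - m : ℕ) : ℝ)⁻¹) Filter.atTop (nhds 1) := by
    simpa using (tendsto_const_nhds (x := (1 : ℝ))).sub ((tendsto_inv_atTop_zero (𝕜 := ℝ)).comp
      (tendsto_natCast_atTop_atTop.comp (Filter.tendsto_sub_atTop_nat m)))
  refine tendsto_of_tendsto_of_tendsto_of_le_of_le' hlim tendsto_const_nhds ?_ ?_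
  · filter_upwards [Filter.eventually_gt_atTop m] with n hn
    have hn0 : n ≠ 0 := by omega
    have hpow : (0 : ℝ) < (n : ℝ) ^ n := by positivity
    have hpos : (0 : ℝ) < ((n - m : ℕ) : ℝ) := by
      exact_mod_cast Nat.sub_pos_of_lt hn
    have hbad := card_few_moved_mul_le (m := m) hn0
    have hsum := hadd n
    replace hbad := Nat.cast_le (α := ℝ).2 hbad
    replace hsum := congrArg (Nat.cast : ℕ → ℝ) hsum
    rw [Nat.cast_mul, Nat.cast_pow] at hbad
    rw [Nat.cast_add, Nat.cast_pow] at hsum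
    have := (le_div_iff₀ hpos).2 hbad
    rw [div_eq_inv_mul] at this
    rw [le_div_iff₀ hpow, sub_mul, one_mul]
    linarith
  · filter_upwards with n
    refine div_le_one_of_le₀ ?_ (by positivity)
    exact_mod_cast Nat.le.intro (hadd n)
end

section
/- The limit, as n → ∞, of the ratio |{f : Fin n → Fin n | ∃ x, f x = x}| / n^n equals 1 − e^{-1}. That is, for the language L = {F} with one unary function symbol, μ((F(x)=x)^{(1)}) = μ(∃x (F(x)=x)) = 1 − e^{-1} = (e−1)/e. -/
/-- The number of self-maps of an `n`-element set without fixed points is `(n - 1) ^ n`. -/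
theorem card_forall_apply_ne (n : ℕ) :
    Nat.card {f : Fin n → Fin n // ∀ x, f x ≠ x} = (n - 1) ^ n := by
  rw [Nat.card_congr (Equiv.subtypePiEquivPi (p := fun (x y : Fin n) => y ≠ x)), Nat.card_pi]
  simp [Nat.card_eq_fintype_card, Fintype.card_subtype_compl]

/-- Self-maps of an `n`-element set split into those with and those without a fixed point. -/
theorem card_exists_apply_eq_add (n : ℕ) :
    Nat.card {f : Fin n → Fin n // ∃ x, f x = x} + (n - 1) ^ n = n ^ n := by
  classical
  have h := Nat.card_congr (Equiv.sumCompl (fun f : Fin n → Fin n => ∃ x, f x = x))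
  rw [Nat.card_sum] at h
  simp only [not_exists] at h
  rw [← card_forall_apply_ne, h]
  simp

/-- For the language `L = {F}` with one unary function symbol,
`μ(∃x (F(x) = x)) = 1 - e⁻¹`. -/
theorem stmt13 :
    Filter.Tendsto
      (fun n : ℕ =>
        (Nat.card {f : Fin n → Fin n // ∃ x, f x = x} : ℝ) / (n : ℝ) ^ n)
      Filter.atTop (nhds (1 - Real.exp (-1))) := by
  refine ((Real.tendsto_one_add_div_pow_exp (-1)).const_sub 1).congr' ?_
  filter_upwards [Filter.eventually_ge_atTop 1] with n hn
  have h : (Nat.card {f : Fin n → Fin n // ∃ x, f x = x} : ℝ) + ((n : ℝ) - 1) ^ n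
      = (n : ℝ) ^ n := by
    have h := congrArg (Nat.cast (R := ℝ)) (card_exists_apply_eq_add n)
    push_cast [Nat.cast_sub hn] at h
    exact h
  have hn0 : (n : ℝ) ≠ 0 := by positivity
  have hb : 1 + -1 / (n : ℝ) = ((n : ℝ) - 1) / n := by
    field_simp
    ring
  rw [eq_sub_of_add_eq h, hb, div_pow, sub_div, div_self (pow_ne_zero n hn0)]
end

section
/- Fix m ≥ 1, and for each n ≥ 1 let a_n = |{f : Fin n → Fin n | |{x : f x = x}| ≥ m}| / n^n. Then (1/(e·m!)) ≤ liminf_{n→∞} a_n and limsup_{n→∞} a_n ≤ 1/m!. (In the paper's notation: e^{-1}/m! ≤ μ((F(x)=x)^{(m)}) ≤ 1/m!.) In particular, since d(F(x)=x : typ) = 0 while these lower bounds are positive for every m, the converse of the criterion 'μ(φ^{(m)}) = 0 for some m implies d(φ:typ) = 0' is false for the language L = {F}. -/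
/-- If `f` has at least `m` fixed points, it fixes some `m`-element set pointwise, so a union
bound over such sets applies. -/
theorem card_le_fixedPoints_le (n m : ℕ) :
    Nat.card {f : Fin n → Fin n // m ≤ Nat.card {x : Fin n // f x = x}}
      ≤ n.choose m * n ^ (n - m) := by
  classical
  rw [Nat.card_eq_fintype_card, Fintype.card_subtype]
  let P (S : Finset (Fin n)) : Finset (Fin n → Fin n) :=
    Fintype.piFinset fun x => if x ∈ S then {x} else Finset.univ
  have hP : ∀ S ∈ Finset.powersetCard m (Finset.univ : Finset (Fin n)),
      (P S).card ≤ n ^ (n - m) := by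
    intro S hS
    have hcard := (Finset.mem_powersetCard.mp hS).2
    simp [P, Fintype.card_piFinset, apply_ite Finset.card, Finset.prod_ite, Finset.filter_not,
      Finset.card_sdiff, hcard]
  refine (Finset.card_le_card ?_).trans
    ((Finset.card_biUnion_le_card_mul _ P _ hP).trans_eq (by simp))
  intro f hf
  have hf : m ≤ (Finset.univ.filter fun x => f x = x).card := by
    simpa [Nat.card_eq_fintype_card, Fintype.card_subtype] using hf
  obtain ⟨S, hS, hcard⟩ := Finset.exists_subset_card_eq hf
  refine Finset.mem_biUnion.mpr ⟨S, by simp [Finset.mem_powersetCard, hcard], ?_⟩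
  simp only [P, Fintype.mem_piFinset]
  intro x
  split_ifs with hx
  · simpa using hS hx
  · simp

/-- At least `n.choose m * (n - 1) ^ (n - m)` self-maps of `Fin n` have `m` or more fixed points:
this is the number of those with exactly `m`. -/
theorem le_card_le_fixedPoints (n m : ℕ) :
    n.choose m * (n - 1) ^ (n - m) ≤
      Nat.card {f : Fin n → Fin n // m ≤ Nat.card {x : Fin n // f x = x}} := by
  classical
  rw [Nat.card_eq_fintype_card, Fintype.card_subtype]
  let P (S : Finset (Fin n)) : Finset (Fin n → Fin n) :=
    Fintype.piFinset fun x => if x ∈ S then {x} else Finset.univ.erase x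
  have hfix : ∀ S, ∀ f ∈ P S, (Finset.univ.filter fun x => f x = x) = S := by
    intro S f hf
    ext x
    have hx := Fintype.mem_piFinset.mp hf x
    by_cases h : x ∈ S <;> simpa [h] using hx
  have hP : ∀ S ∈ Finset.powersetCard m (Finset.univ : Finset (Fin n)),
      (P S).card = (n - 1) ^ (n - m) := by
    intro S hS
    have hcard := (Finset.mem_powersetCard.mp hS).2
    simp [P, Fintype.card_piFinset, apply_ite Finset.card, Finset.prod_ite, Finset.filter_not,
      Finset.card_sdiff, hcard]
  have hdisj : ((Finset.powersetCard m (Finset.univ : Finset (Fin n))) : Set _).PairwiseDisjoint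
      P := fun S _ T _ hST => Finset.disjoint_left.mpr fun f hS hT =>
    hST ((hfix S f hS).symm.trans (hfix T f hT))
  have hunion := Finset.card_biUnion hdisj
  rw [Finset.sum_const_nat hP, Finset.card_powersetCard, Finset.card_univ, Fintype.card_fin]
    at hunion
  rw [← hunion]
  refine Finset.card_le_card fun f hf => ?_
  obtain ⟨S, hS, hfS⟩ := Finset.mem_biUnion.mp hf
  have hcard := (Finset.mem_powersetCard.mp hS).2
  simp [Nat.card_eq_fintype_card, Fintype.card_subtype, hfix S f hfS, hcard]

/-- The proportion of self-maps of an `n`-element set with exactly `m` fixed points tends to the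
Poisson weight `e⁻¹ / m!`. -/
theorem tendsto_choose_mul_pred_pow_div (m : ℕ) :
    Filter.Tendsto (fun n : ℕ => ((n.choose m * (n - 1) ^ (n - m) : ℕ) : ℝ) / (n : ℝ) ^ n)
      Filter.atTop (nhds (1 / (Real.exp 1 * (m.factorial : ℝ)))) := by
  have hmean : Filter.Tendsto (fun n : ℕ => (n : ℝ) * (1 / (n : ℝ))) Filter.atTop (nhds 1) := by
    refine tendsto_const_nhds.congr' ?_
    filter_upwards [Filter.eventually_ne_atTop 0] with n hn
    field_simp
  have hlim := ProbabilityTheory.tendsto_choose_mul_pow_of_tendsto_mul_atTop m hmean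
  have hvalue : 1 / (Real.exp 1 * (m.factorial : ℝ)) = Real.exp (-1) * 1 ^ m / m.factorial := by
    rw [Real.exp_neg]
    field_simp
    simp
  rw [hvalue]
  refine hlim.congr' ?_
  filter_upwards [Filter.eventually_ge_atTop (m + 1)] with n hn
  have hn0 : (n : ℝ) ≠ 0 := by exact_mod_cast (by omega : n ≠ 0)
  rw [one_sub_div hn0, Nat.cast_mul, Nat.cast_pow, Nat.cast_sub (by omega : 1 ≤ n), Nat.cast_one,
    div_pow, div_pow, one_pow, ← pow_mul_pow_sub (n : ℝ) (by omega : m ≤ n)]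
  field_simp

/-- For the language `L = {F}` with one unary function symbol and each `m ≥ 1`,
`e⁻¹/m! ≤ liminf μ_n((F(x)=x)^{(m)})` and `limsup μ_n((F(x)=x)^{(m)}) ≤ 1/m!`. -/
theorem stmt14 (m : ℕ) (hm : 1 ≤ m) :
    1 / (Real.exp 1 * (m.factorial : ℝ)) ≤
        Filter.liminf
          (fun n : ℕ =>
            (Nat.card {f : Fin n → Fin n // m ≤ Nat.card {x : Fin n // f x = x}} : ℝ)
              / (n : ℝ) ^ n)
          Filter.atTop ∧
      Filter.limsup
          (fun n : ℕ =>
            (Nat.card {f : Fin n → Fin n // m ≤ Nat.card {x : Fin n // f x = x}} : ℝ)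
              / (n : ℝ) ^ n)
          Filter.atTop ≤ 1 / (m.factorial : ℝ) := by
  have hupper : ∀ᶠ n : ℕ in Filter.atTop,
      (Nat.card {f : Fin n → Fin n // m ≤ Nat.card {x : Fin n // f x = x}} : ℝ) / (n : ℝ) ^ n
        ≤ 1 / (m.factorial : ℝ) := by
    filter_upwards [Filter.eventually_ge_atTop m] with n hn
    have hcard : (Nat.card {f : Fin n → Fin n // m ≤ Nat.card {x : Fin n // f x = x}} : ℝ)
        ≤ n.choose m * (n : ℝ) ^ (n - m) := by exact_mod_cast card_le_fixedPoints_le n m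
    have hpos : (0 : ℝ) < (n : ℝ) ^ n := by
      have : (0 : ℝ) < n := by exact_mod_cast (by omega : 0 < n)
      positivity
    rw [div_le_iff₀ hpos]
    refine hcard.trans ((mul_le_mul_of_nonneg_right (Nat.choose_le_pow_div m n)
      (by positivity)).trans_eq ?_)
    rw [div_mul_eq_mul_div, ← pow_add, Nat.add_sub_cancel' hn]
    ring
  have hlim := tendsto_choose_mul_pred_pow_div m
  refine ⟨?_, ?_⟩
  · rw [← hlim.liminf_eq]
    refine Filter.liminf_le_liminf (Filter.Eventually.of_forall fun n => ?_)
      hlim.isBoundedUnder_ge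
      (Filter.isBoundedUnder_of_eventually_le hupper).isCoboundedUnder_ge
    gcongr
    exact le_card_le_fixedPoints n m
  · exact Filter.limsup_le_of_le
      (Filter.isBoundedUnder_of ⟨0, fun n => by positivity⟩ |>.isCoboundedUnder_le) hupper
end

section
/- The fraction of simple graphs G on the vertex set Fin n such that 2·|{x : x is an isolated vertex of G}| > n (out of all 2^{C(n,2)} simple graphs on Fin n) tends to 0 as n → ∞. That is, for the language of graphs, the property φ_none(x) := ∀y ¬(xEy) ('x is an isolated node') has typicality degree d(φ_none : typ) = 0. -/
open scoped symmDiff in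
/-- The translates of a family of graphs by the stars are pairwise disjoint as soon as any two
members of the family have a common isolated vertex. -/
theorem SimpleGraph.eq_of_symmDiff_starGraph_eq {n : ℕ} (hn : 3 ≤ n) {G H : SimpleGraph (Fin n)}
    {i j x : Fin n} (hG : ∀ y, ¬ G.Adj x y) (hH : ∀ y, ¬ H.Adj x y)
    (h : G ∆ starGraph i = H ∆ starGraph j) : i = j := by
  have key : ∀ y, (starGraph i).Adj x y ↔ (starGraph j).Adj x y := fun y => by
    have := congrArg (fun K : SimpleGraph (Fin n) => K.Adj x y) h
    simpa only [symmDiff, sup_adj, sdiff_adj, hG y, hH y, false_and, not_false_eq_true, and_true,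
      false_or, eq_iff_iff] using this
  simp only [starGraph_adj] at key
  obtain ⟨y, hyi, hyj⟩ := Finset.exists_mem_notMem_of_card_lt_card
    (s := {i, j}) (t := Finset.univ) (Finset.card_le_two.trans_lt (by simp; omega))
      |>.imp fun y hy => (by simpa using hy : y ≠ i ∧ y ≠ j)
  have h₁ := key y
  have h₂ := key i
  have h₃ := key j
  grind

theorem SimpleGraph.natCard_fin_le (n : ℕ) :
    Nat.card (SimpleGraph (Fin n)) ≤ 2 ^ n.choose 2 := by
  have hcard : Nat.card ((Sym2.diagSet : Set (Sym2 (Fin n)))ᶜ : Set _) = n.choose 2 := by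
    rw [Nat.card_coe_set_eq, Sym2.ncard_diagSet_compl, Nat.card_fin]
  rw [← hcard, Nat.card_coe_set_eq, ← Set.ncard_powerset, ← Nat.card_coe_set_eq]
  refine Nat.card_le_card_of_injective (β := 𝒫 (Sym2.diagSet : Set (Sym2 (Fin n)))ᶜ)
    (fun G => ⟨G.edgeSet, fun e he => G.not_isDiag_of_mem_edgeSet he⟩) ?_
  intro G H h
  exact edgeSet_injective (congrArg Subtype.val h)

theorem Fin.exists_and_of_lt_two_mul_natCard {n : ℕ} {p q : Fin n → Prop}
    (hp : n < 2 * Nat.card {x // p x}) (hq : n < 2 * Nat.card {x // q x}) : ∃ x, p x ∧ q x := by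
  classical
  rw [Nat.subtype_card (Finset.univ.filter p) (by simp)] at hp
  rw [Nat.subtype_card (Finset.univ.filter q) (by simp)] at hq
  obtain ⟨x, hx⟩ := Finset.inter_nonempty_of_card_lt_card_add_card
    (Finset.filter_subset p Finset.univ) (Finset.filter_subset q Finset.univ)
    (by rw [Finset.card_univ, Fintype.card_fin]; omega)
  exact ⟨x, by simpa using hx⟩

open scoped symmDiff in
theorem SimpleGraph.mul_natCard_majority_isolated_le {n : ℕ} (hn : 3 ≤ n) :
    n * Nat.card {G : SimpleGraph (Fin n) // n < 2 * Nat.card {x : Fin n // ∀ y, ¬ G.Adj x y}}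
      ≤ 2 ^ n.choose 2 := by
  refine le_trans ?_ (natCard_fin_le n)
  set P := {G : SimpleGraph (Fin n) // n < 2 * Nat.card {x : Fin n // ∀ y, ¬ G.Adj x y}}
  have hcard : Nat.card (Fin n × P) = n * Nat.card P := by rw [Nat.card_prod, Nat.card_fin]
  rw [← hcard]
  refine Nat.card_le_card_of_injective (fun a => a.2.1 ∆ starGraph a.1) ?_
  rintro ⟨i, G, hG⟩ ⟨j, H, hH⟩ h
  obtain ⟨x, hxG, hxH⟩ := Fin.exists_and_of_lt_two_mul_natCard hG hH
  obtain rfl := eq_of_symmDiff_starGraph_eq hn hxG hxH h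
  obtain rfl : G = H := symmDiff_left_injective _ h
  rfl

/-- For the language of graphs, the property `φ_none(x) := ∀y ¬(xEy)` ("x is an isolated
node") has typicality degree `0`: the fraction of simple graphs on `Fin n` (out of all
`2^(n choose 2)`) in which more than half the vertices are isolated tends to `0`. -/
theorem stmt15 :
    Filter.Tendsto
      (fun n : ℕ =>
        (Nat.card {G : SimpleGraph (Fin n) //
            n < 2 * Nat.card {x : Fin n // ∀ y, ¬ G.Adj x y}} : ℝ)
          / (2 : ℝ) ^ n.choose 2)
      Filter.atTop (nhds 0) := by
  refine tendsto_of_tendsto_of_tendsto_of_le_of_le' tendsto_const_nhds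
    tendsto_one_div_atTop_nhds_zero_nat (Filter.Eventually.of_forall fun n => by positivity) ?_
  filter_upwards [Filter.eventually_ge_atTop 3] with n hn
  have hpos : (0 : ℝ) < n := by exact_mod_cast (by omega : 0 < n)
  rw [div_le_div_iff₀ (by positivity) hpos, one_mul, mul_comm]
  exact_mod_cast SimpleGraph.mul_natCard_majority_isolated_le hn
end

section
/- The fraction of simple graphs G on the vertex set Fin n such that 2·|{x : x is adjacent in G to every other vertex}| > n (out of all 2^{C(n,2)} simple graphs on Fin n) tends to 0 as n → ∞. That is, for the language of graphs, the property φ_all(x) := ∀y (xEy) ('x is adjacent to every node') has typicality degree d(φ_all : typ) = 0. -/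
theorem SimpleGraph.card_le_two_pow_choose (V : Type*) [Finite V] :
    Nat.card (SimpleGraph V) ≤ 2 ^ (Nat.card V).choose 2 := by
  classical
  have := Fintype.ofFinite V
  have hinj : Function.Injective
      (fun G : SimpleGraph V => {e : {e : Sym2 V // ¬ e.IsDiag} | e.1 ∈ G.edgeSet}) := by
    intro G H h
    ext x y
    by_cases hxy : x = y
    · simp [hxy]
    · have := Set.ext_iff.1 h ⟨s(x, y), by simpa using hxy⟩
      simpa using this
  refine (Nat.card_le_card_of_injective _ hinj).trans ?_
  rw [Nat.card_eq_fintype_card, Fintype.card_set, Sym2.card_subtype_not_diag,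
    Nat.card_eq_fintype_card]

theorem SimpleGraph.card_universal_vertex_le (n : ℕ) (x : Fin (n + 1)) :
    Nat.card {G : SimpleGraph (Fin (n + 1)) // ∀ y, y ≠ x → G.Adj x y} ≤ 2 ^ n.choose 2 := by
  have hinj : Function.Injective
      (fun G : {G : SimpleGraph (Fin (n + 1)) // ∀ y, y ≠ x → G.Adj x y} =>
        G.1.comap (Subtype.val : {y // y ≠ x} → Fin (n + 1))) := by
    rintro ⟨G, hG⟩ ⟨H, hH⟩ h
    ext a b
    by_cases ha : a = x
    · subst ha
      by_cases hb : b = a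
      · simp [hb]
      · simp [hG b hb, hH b hb]
    · by_cases hb : b = x
      · subst hb
        simp [(hG a ha).symm, (hH a ha).symm]
      · have := congrArg (fun K : SimpleGraph {y // y ≠ x} => K.Adj ⟨a, ha⟩ ⟨b, hb⟩) h
        simpa using this
  have hcard : Nat.card {y : Fin (n + 1) // y ≠ x} = n := by
    simp [Nat.card_eq_fintype_card, Fintype.card_subtype_compl]
  refine (Nat.card_le_card_of_injective _ hinj).trans ?_
  simpa only [hcard] using SimpleGraph.card_le_two_pow_choose {y : Fin (n + 1) // y ≠ x}

theorem SimpleGraph.card_mostly_universal_le (n : ℕ) :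
    Nat.card {G : SimpleGraph (Fin (n + 1)) //
      n + 1 < 2 * Nat.card {x : Fin (n + 1) // ∀ y, y ≠ x → G.Adj x y}}
      ≤ (n + 1) * 2 ^ n.choose 2 := by
  have hex : ∀ G : {G : SimpleGraph (Fin (n + 1)) //
      n + 1 < 2 * Nat.card {x : Fin (n + 1) // ∀ y, y ≠ x → G.Adj x y}},
      ∃ x, ∀ y, y ≠ x → G.1.Adj x y := by
    rintro ⟨G, hG⟩
    have : 0 < Nat.card {x : Fin (n + 1) // ∀ y, y ≠ x → G.Adj x y} := by omega
    obtain ⟨⟨x, hx⟩⟩ := (Nat.card_pos_iff.1 this).1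
    exact ⟨x, hx⟩
  choose f hf using hex
  have hinj : Function.Injective (fun G => (⟨f G, G.1, hf G⟩ :
      Σ x : Fin (n + 1), {G : SimpleGraph (Fin (n + 1)) // ∀ y, y ≠ x → G.Adj x y})) :=
    Function.Injective.of_comp (f := fun p => p.2.1) Subtype.val_injective
  refine (Nat.card_le_card_of_injective _ hinj).trans ?_
  rw [Nat.card_sigma]
  refine (Finset.sum_le_sum fun x _ => SimpleGraph.card_universal_vertex_le n x).trans ?_
  simp

/-- For the language of graphs, the property `φ_all(x) := ∀y (xEy)` ("x is adjacent to
every node") has typicality degree `0`. -/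
theorem stmt16 :
    Filter.Tendsto
      (fun n : ℕ =>
        (Nat.card {G : SimpleGraph (Fin n) //
            n < 2 * Nat.card {x : Fin n // ∀ y, y ≠ x → G.Adj x y}} : ℝ)
          / (2 : ℝ) ^ n.choose 2)
      Filter.atTop (nhds 0) := by
  rw [← Filter.tendsto_add_atTop_iff_nat 1]
  have hlim : Filter.Tendsto (fun n : ℕ => 2 * (((n + 1 : ℕ) : ℝ) * (1 / 2) ^ (n + 1)))
      Filter.atTop (nhds 0) := by
    simpa using ((Filter.tendsto_add_atTop_iff_nat 1).2
      (tendsto_self_mul_const_pow_of_lt_one (r := (1 / 2 : ℝ)) (by norm_num)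
        (by norm_num))).const_mul 2
  refine squeeze_zero (fun n => by positivity) (fun n => ?_) hlim
  have hle : (Nat.card {G : SimpleGraph (Fin (n + 1)) //
      n + 1 < 2 * Nat.card {x : Fin (n + 1) // ∀ y, y ≠ x → G.Adj x y}} : ℝ)
      ≤ (n + 1) * 2 ^ n.choose 2 := by
    exact_mod_cast SimpleGraph.card_mostly_universal_le n
  rw [div_le_iff₀ (by positivity), Nat.choose_succ_succ' n 1, Nat.choose_one_right]
  refine hle.trans_eq ?_
  have h : (1 / 2 : ℝ) ^ n * 2 ^ n = 1 := by rw [← mul_pow]; norm_num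
  push_cast
  rw [pow_add, pow_succ]
  linear_combination (-((n : ℝ) + 1) * 2 ^ n.choose 2) * h
end

section
/- For each k ≥ 1, the fraction of simple graphs G on the vertex set Fin n such that 2·|{x : the degree of x in G is exactly k}| > n (out of all 2^{C(n,2)} simple graphs on Fin n) tends to 0 as n → ∞. That is, the property φ_k(x) := 'x is adjacent to exactly k nodes' has typicality degree d(φ_k : typ) = 0; in particular this holds for φ_one(x) := ∃!y (xEy) with k = 1. -/
theorem SimpleGraph.natCard_le_two_pow_choose (V : Type*) [Fintype V] :
    Nat.card (SimpleGraph V) ≤ 2 ^ (Fintype.card V).choose 2 := by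
  classical
  rw [Nat.card_eq_fintype_card, ← SimpleGraph.card_edgeFinset_top_eq_card_choose_two,
    ← Finset.card_powerset, ← Finset.card_univ]
  refine Finset.card_le_card_of_injOn (fun G => G.edgeFinset) (fun G _ => ?_) ?_
  · simp
  · exact fun G _ H _ h => SimpleGraph.edgeFinset_inj.1 h

/-- A graph on `Fin (m + 1)` is determined by the neighbours of a vertex `x` and by the graph
induced on the other vertices. -/
theorem SimpleGraph.ext_of_comap_succAbove {m : ℕ} (x : Fin (m + 1))
    {G H : SimpleGraph (Fin (m + 1))}
    (hx : ∀ i, G.Adj x (x.succAbove i) ↔ H.Adj x (x.succAbove i))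
    (h : G.comap x.succAbove = H.comap x.succAbove) : G = H := by
  ext a b
  rcases Fin.eq_self_or_eq_succAbove x a with ha | ⟨i, rfl⟩ <;>
    rcases Fin.eq_self_or_eq_succAbove x b with hb | ⟨j, rfl⟩
  · simp [ha, hb]
  · rw [ha, hx]
  · rw [hb, G.adj_comm, H.adj_comm, hx]
  · rw [← SimpleGraph.comap_adj, h, SimpleGraph.comap_adj]

/-- The number of graphs on `Fin (m + 1)` in which a given vertex has degree `k` is at most
`C(m, k) * 2 ^ C(m, 2)`. -/
theorem SimpleGraph.natCard_degree_eq_le (m k : ℕ) (x : Fin (m + 1)) :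
    Nat.card {G : SimpleGraph (Fin (m + 1)) // Nat.card {y // G.Adj x y} = k}
      ≤ m.choose k * 2 ^ m.choose 2 := by
  classical
  have key : ∀ G : SimpleGraph (Fin (m + 1)), Nat.card {y // G.Adj x y} = k →
      (Finset.univ.filter fun i => G.Adj x (x.succAbove i)).card = k := by
    intro G hG
    rw [← hG, Nat.card_eq_fintype_card, Fintype.card_subtype,
      ← Finset.card_map (Fin.succAboveEmb x)]
    congr 1
    ext y
    rcases Fin.eq_self_or_eq_succAbove x y with hy | ⟨i, rfl⟩
    · simp [hy]
    · simp
  let f : {G : SimpleGraph (Fin (m + 1)) // Nat.card {y // G.Adj x y} = k} →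
      {s : Finset (Fin m) // s.card = k} × SimpleGraph (Fin m) := fun G =>
    (⟨Finset.univ.filter fun i => G.1.Adj x (x.succAbove i), key G.1 G.2⟩,
      G.1.comap x.succAbove)
  have hf : Function.Injective f := by
    intro G H h
    obtain ⟨h₁, h₂⟩ := Prod.ext_iff.1 h
    refine Subtype.ext (SimpleGraph.ext_of_comap_succAbove x (fun i => ?_) h₂)
    simpa [f] using Finset.ext_iff.1 (Subtype.ext_iff.1 h₁) i
  refine (Nat.card_le_card_of_injective f hf).trans ?_
  rw [Nat.card_prod, Nat.card_eq_fintype_card, Fintype.card_finset_len, Fintype.card_fin]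
  simpa using Nat.mul_le_mul_left (m.choose k) (SimpleGraph.natCard_le_two_pow_choose (Fin m))

/-- Markov's inequality for a relation between two finite types. -/
theorem Nat.card_mul_card_le_of_forall_card_le {α β : Type*} [Fintype α] [Fintype β]
    (r : α → β → Prop) (B : ℕ) (hB : ∀ b, Nat.card {a // r a b} ≤ B) :
    Nat.card {a // Fintype.card β < 2 * Nat.card {b // r a b}} * Fintype.card β
      ≤ 2 * (Fintype.card β * B) := by
  classical
  simp only [Nat.card_eq_fintype_card, Fintype.card_subtype] at hB ⊢
  calc (Finset.univ.filter fun a =>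
          Fintype.card β < 2 * (Finset.univ.filter fun b => r a b).card).card * Fintype.card β
      ≤ ∑ a ∈ Finset.univ.filter fun a =>
          Fintype.card β < 2 * (Finset.univ.filter fun b => r a b).card,
          2 * (Finset.univ.filter fun b => r a b).card := by
        rw [← smul_eq_mul]
        exact Finset.card_nsmul_le_sum _ _ _ fun a ha => (Finset.mem_filter.1 ha).2.le
    _ ≤ ∑ a, 2 * (Finset.univ.filter fun b => r a b).card :=
        Finset.sum_le_sum_of_subset (Finset.filter_subset _ _)
    _ = 2 * ∑ b, (Finset.univ.filter fun a => r a b).card := by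
        rw [← Finset.mul_sum]
        exact congrArg _ (Finset.sum_card_bipartiteAbove_eq_sum_card_bipartiteBelow r)
    _ ≤ 2 * (Fintype.card β * B) := by
        refine Nat.mul_le_mul_left 2 ?_
        simpa using Finset.sum_le_card_nsmul Finset.univ _ B fun b _ => hB b

/-- For each `k ≥ 1`, the graph property `φ_k(x)` ("x is adjacent to exactly `k` nodes")
has typicality degree `0`. For `k = 1` this is `φ_one(x) := ∃!y (xEy)`. -/
theorem stmt17 (k : ℕ) (hk : 1 ≤ k) :
    Filter.Tendsto
      (fun n : ℕ =>
        (Nat.card {G : SimpleGraph (Fin n) //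
            n < 2 * Nat.card {x : Fin n // Nat.card {y : Fin n // G.Adj x y} = k}} : ℝ)
          / (2 : ℝ) ^ n.choose 2)
      Filter.atTop (nhds 0) := by
  rw [← Filter.tendsto_add_atTop_iff_nat 1]
  have hlim : Filter.Tendsto (fun m : ℕ => 2 * ((m : ℝ) ^ k / 2 ^ m)) Filter.atTop (nhds 0) := by
    simpa using (tendsto_pow_const_div_const_pow_of_one_lt k (one_lt_two (α := ℝ))).const_mul 2
  refine squeeze_zero (fun m => by positivity) (fun m => ?_) hlim
  have hcard := Nat.card_mul_card_le_of_forall_card_le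
    (fun (G : SimpleGraph (Fin (m + 1))) x => Nat.card {y // G.Adj x y} = k)
    (m.choose k * 2 ^ m.choose 2) (SimpleGraph.natCard_degree_eq_le m k)
  rw [Fintype.card_fin, mul_left_comm, mul_comm] at hcard
  have hle := (Nat.le_of_mul_le_mul_left hcard m.succ_pos).trans
    (Nat.mul_le_mul_left 2 (Nat.mul_le_mul_right _ (Nat.choose_le_pow m k)))
  have hreal := (Nat.cast_le (α := ℝ)).2 hle
  push_cast at hreal
  rw [Nat.choose_succ_succ' m 1, Nat.choose_one_right, pow_add, div_le_iff₀ (by positivity)]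
  refine hreal.trans_eq ?_
  field_simp
end
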